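/- Let N ≥ 3 and let x̂ ∈ (x̲, x̄]. Then the expectation of the maximum of N−1 i.i.d. draws from F conditional on all of them being at most x̂ strictly exceeds the expectation of the maximum of N−2 such draws conditional on all of them being at most x̂; that is, (1/F(x̂)^{N−1})·∫_{x̲}^{x̂} y·(N−1)·F(y)^{N−2}·f(y) dy > (1/F(x̂)^{N−2})·∫_{x̲}^{x̂} y·(N−2)·F(y)^{N−3}·f(y) dy. (This inequality shows that the two necessary conditions for a strictly increasing symmetric equilibrium of a first- or second-price auction with reserve price followed by a second-price auction are incompatible, so no such equilibrium exists.) -/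

import Mathlib

open Set MeasureTheory intervalIntegral

/-- The primitive of a function continuous on an interval has that function as derivative at
interior points. -/
lemma hasDerivAt_of_eqOn_primitive {a b : ℝ} {F f : ℝ → ℝ}
    (hf : ContinuousOn f (Icc a b)) (hF : ∀ x ∈ Icc a b, F x = ∫ t in a..x, f t)
    {x : ℝ} (hx : x ∈ Ioo a b) : HasDerivAt F (f x) x := by
  have hint : IntervalIntegrable f volume a x :=
    (hf.mono (Icc_subset_Icc_right hx.2.le)).intervalIntegrable_of_Icc hx.1.le
  have hderiv := integral_hasDerivAt_right hint
    ((hf.mono Ioo_subset_Icc_self).stronglyMeasurableAtFilter isOpen_Ioo x hx)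
    (hf.continuousAt (Icc_mem_nhds hx.1 hx.2))
  refine hderiv.congr_of_eventuallyEq ?_
  filter_upwards [Icc_mem_nhds hx.1 hx.2] with y hy using hF y hy

/-- The primitive of a function continuous on a compact interval is continuous there. -/
lemma continuousOn_of_eqOn_primitive {a b : ℝ} (hab : a ≤ b) {F f : ℝ → ℝ}
    (hf : ContinuousOn f (Icc a b)) (hF : ∀ x ∈ Icc a b, F x = ∫ t in a..x, f t) :
    ContinuousOn F (Icc a b) := by
  have h := continuousOn_primitive_interval (μ := volume) (f := f) (a := a) (b := b)
    (by rw [uIcc_of_le hab]; exact hf.integrableOn_Icc)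
  rw [uIcc_of_le hab] at h
  exact h.congr hF

/-- Integration by parts for the unnormalised expectation of the maximum of `k + 1` draws. -/
lemma integral_mul_pow_mul_density {a b : ℝ} (hab : a ≤ b) {F f : ℝ → ℝ}
    (hf : ContinuousOn f (Icc a b)) (hF : ∀ x ∈ Icc a b, F x = ∫ t in a..x, f t) (k : ℕ) :
    ∫ y in a..b, y * ((k : ℝ) + 1) * F y ^ k * f y
      = b * F b ^ (k + 1) - ∫ y in a..b, F y ^ (k + 1) := by
  have hFc := continuousOn_of_eqOn_primitive hab hf hF
  have hFa : F a = 0 := by simp [hF a (left_mem_Icc.2 hab)]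
  have hi₁ : IntervalIntegrable (fun y => y * ((k : ℝ) + 1) * F y ^ k * f y) volume a b :=
    ContinuousOn.intervalIntegrable_of_Icc hab (by fun_prop)
  have hi₂ : IntervalIntegrable (fun y => F y ^ (k + 1)) volume a b :=
    ContinuousOn.intervalIntegrable_of_Icc hab (by fun_prop)
  have key := integral_eq_sub_of_hasDerivAt_of_le (f := fun y => y * F y ^ (k + 1)) hab
    (by fun_prop)
    (fun x hx => by
      have h := (hasDerivAt_id x).mul ((hasDerivAt_of_eqOn_primitive hf hF hx).pow (k + 1))
      refine h.congr_deriv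
        (g' := x * ((k : ℝ) + 1) * F x ^ k * f x + F x ^ (k + 1)) ?_
      simp
      ring)
    (hi₁.add hi₂)
  rw [integral_add hi₁ hi₂] at key
  simp only [hFa] at key
  rw [zero_pow k.succ_ne_zero] at key
  linarith


/-- For `N ≥ 3` and `x̂ ∈ (x̲, x̄]`, the expectation of the
maximum of `N−1` i.i.d. draws from `F` conditional on all being at most `x̂`
strictly exceeds the expectation of the maximum of `N−2` such draws conditional
on all being at most `x̂`. (Hence the two necessary conditions for a strictly
increasing symmetric equilibrium of a first- or second-price auction with
reserve price followed by a second-price auction are incompatible, so no such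
equilibrium exists.) -/
theorem conditional_max_expectation_strict_inequality
    (N : ℕ) (hN : 3 ≤ N)
    (xl xu : ℝ) (hxl : 0 ≤ xl) (hlt : xl < xu)
    (F f : ℝ → ℝ)
    (hf_cont : ContinuousOn f (Set.Icc xl xu))
    (hf_pos : ∀ x ∈ Set.Icc xl xu, 0 < f x)
    (hF : ∀ x ∈ Set.Icc xl xu, F x = ∫ t in xl..x, f t)
    (hFxu : F xu = 1)
    (xh : ℝ) (hxh : xh ∈ Set.Ioc xl xu) :
    (1 / (F xh) ^ (N - 1)) *
        (∫ y in xl..xh, y * ((N : ℝ) - 1) * (F y) ^ (N - 2) * f y)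
      > (1 / (F xh) ^ (N - 2)) *
          (∫ y in xl..xh, y * ((N : ℝ) - 2) * (F y) ^ (N - 3) * f y) := by
  obtain ⟨n, rfl⟩ := Nat.exists_eq_add_of_le' hN
  have hab := hxh.1
  have hsub : Icc xl xh ⊆ Icc xl xu := Icc_subset_Icc_right hxh.2
  have hf := hf_cont.mono hsub
  have hF' : ∀ x ∈ Icc xl xh, F x = ∫ t in xl..x, f t := fun x hx => hF x (hsub hx)
  have hFc := continuousOn_of_eqOn_primitive hab.le hf hF'
  have hmono : StrictMonoOn F (Icc xl xh) :=
    strictMonoOn_of_deriv_pos (convex_Icc _ _) hFc fun x hx => by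
      rw [interior_Icc] at hx
      rw [(hasDerivAt_of_eqOn_primitive hf hF' hx).deriv]
      exact hf_pos x (hsub (Ioo_subset_Icc_self hx))
  have hFa : F xl = 0 := by simp [hF xl (left_mem_Icc.2 hlt.le)]
  have hpos : ∀ x ∈ Ioc xl xh, 0 < F x := fun x hx =>
    hFa ▸ hmono (left_mem_Icc.2 hab.le) (Ioc_subset_Icc_self hx) hx.1
  have hFh : 0 < F xh := hpos xh (right_mem_Ioc.2 hab)
  have hle : ∀ x ∈ Icc xl xh, F x ≤ F xh := fun x hx =>
    hmono.monotoneOn hx (right_mem_Icc.2 hab.le) hx.2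
  have hlt_int : ∫ y in xl..xh, F y ^ (n + 2) < ∫ y in xl..xh, F xh * F y ^ (n + 1) := by
    refine integral_lt_integral_of_continuousOn_of_le_of_exists_lt hab (by fun_prop)
      (by fun_prop) (fun x hx => ?_) ⟨(xl + xh) / 2, ⟨by linarith, by linarith⟩, ?_⟩
    · rw [pow_succ' (F x) (n + 1)]
      exact mul_le_mul_of_nonneg_right (hle x (Ioc_subset_Icc_self hx))
        (pow_pos (hpos x hx) _).le
    · have hm : (xl + xh) / 2 ∈ Ioc xl xh := ⟨by linarith, by linarith⟩
      rw [pow_succ' _ (n + 1)]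
      exact mul_lt_mul_of_pos_right
        (hmono (Ioc_subset_Icc_self hm) (right_mem_Icc.2 hab.le) (by linarith))
        (pow_pos (hpos _ hm) _)
  rw [intervalIntegral.integral_const_mul] at hlt_int
  have e₁ := integral_mul_pow_mul_density hab.le hf hF' (n + 1)
  have e₂ := integral_mul_pow_mul_density hab.le hf hF' n
  have c₁ : ((n + 3 : ℕ) : ℝ) - 1 = ((n + 1 : ℕ) : ℝ) + 1 := by push_cast; ring
  have c₂ : ((n + 3 : ℕ) : ℝ) - 2 = (n : ℝ) + 1 := by push_cast; ring
  rw [c₁, c₂, show n + 3 - 1 = n + 2 from rfl, show n + 3 - 2 = n + 1 from rfl,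
    show n + 3 - 3 = n from rfl, e₁, e₂, gt_iff_lt, one_div_mul_eq_div, one_div_mul_eq_div,
    div_lt_div_iff₀ (by positivity) (by positivity)]
  have hscaled := mul_lt_mul_of_pos_right hlt_int (pow_pos hFh (n + 1))
  ring_nf at hscaled ⊢
  linarith
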